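/- arXiv:1108.0371 — 3 statements merged into one kernel-verified Lean document; each statement's English description precedes it below -/
import Mathlib

section
/- Let $U$ be a Noetherian ring, $y \in J(U)$ a regular normal element such that $U/yU$ is Artinian and $U$ is $y$-adically complete. Then $U$ has Krull dimension at most $1$ on both sides. -/
/-- A module `M` has Gabriel–Rentschler Krull dimension at most `1`:
in every descending chain of submodules, all but finitely many successive factors
are Artinian (Krull dimension `≤ 0`). -/
def KrullDimLEOne (R M : Type*) [Ring R] [AddCommGroup M] [Module R M] : Prop :=
  ∀ N : ℕ → Submodule R M, (∀ n : ℕ, N (n + 1) ≤ N n) →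
    ∃ t : ℕ, ∀ n ≥ t, IsArtinian R (↥(N n) ⧸ (Submodule.comap (N n).subtype (N (n + 1))))

/-- A ring `A` is `z`-adically complete: every Cauchy sequence for the `z`-adic
filtration converges. -/
def ZAdicComplete (A : Type*) [Ring A] (z : A) : Prop :=
  ∀ f : ℕ → A,
    (∀ n : ℕ, ∃ t : ℕ, ∀ i ≥ t, ∀ j ≥ t, f i - f j ∈ Ideal.span {z ^ n}) →
    ∃ L : A, ∀ n : ℕ, ∃ t : ℕ, ∀ i ≥ t, f i - L ∈ Ideal.span {z ^ n}

open MulOpposite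

theorem kd_isUnit_of_mem {R : Type*} [Ring R] {x : R} (hx : x ∈ Ring.jacobson R) :
    IsUnit (1 + x) := by
  rw [← Ideal.jacobson_bot] at hx
  have key : ∀ w ∈ (⊥ : Ideal R).jacobson, ∃ z, z * (1 + w) = 1 := by
    intro w hw
    obtain ⟨z, hz⟩ := Ideal.mem_jacobson_iff.1 hw 1
    refine ⟨z, ?_⟩
    rw [Ideal.mem_bot, sub_eq_zero] at hz
    rw [mul_add, mul_one, add_comm, ← hz, mul_one]
  obtain ⟨z, hz⟩ := key x hx
  obtain ⟨t, ht⟩ := key (-(z * x)) (neg_mem (Ideal.mul_mem_left _ _ hx))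
  have h1 : 1 + -(z * x) = z := by rw [← hz]; noncomm_ring
  rw [h1] at ht
  have : t = 1 + x := left_inv_eq_right_inv ht hz
  subst this
  exact ⟨⟨1 + x, z, ht, hz⟩, rfl⟩

theorem kd_mem_iff {R : Type*} [Ring R] {x : R} :
    x ∈ Ring.jacobson R ↔ ∀ y, IsUnit (1 + y * x) := by
  refine ⟨fun h y => kd_isUnit_of_mem (Ideal.mul_mem_left _ _ h), fun h => ?_⟩
  rw [← Ideal.jacobson_bot, Ideal.mem_jacobson_iff]
  intro y
  obtain ⟨u, hu⟩ := h y
  refine ⟨(↑u⁻¹ : R), ?_⟩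
  have : (↑u⁻¹ : R) * (1 + y * x) = 1 := by rw [← hu]; simp
  rw [Ideal.mem_bot, ← this]; noncomm_ring

theorem kd_swap {R : Type*} [Ring R] {x y : R} (h : IsUnit (1 + y * x)) : IsUnit (1 + x * y) := by
  obtain ⟨⟨_, v, h1, h2⟩, rfl⟩ := h
  refine ⟨⟨1 + x * y, 1 - x * v * y, ?_, ?_⟩, rfl⟩
  · calc _ = 1 + x * y - x * ((1 + y * x) * v) * y := by noncomm_ring
      _ = 1 := by rw [h1]; noncomm_ring
  · calc _ = 1 + x * y - x * (v * (1 + y * x)) * y := by noncomm_ring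
      _ = 1 := by rw [h2]; noncomm_ring

theorem kd_op_mem {R : Type*} [Ring R] {x : R} :
    op x ∈ Ring.jacobson Rᵐᵒᵖ ↔ x ∈ Ring.jacobson R := by
  rw [kd_mem_iff, kd_mem_iff]
  constructor
  · intro h y
    have := h (op y)
    rw [← op_mul, ← op_one, ← op_add, isUnit_op] at this
    exact kd_swap this
  · intro h y
    have := kd_swap (h (unop y))
    rw [← isUnit_op] at this
    simpa using this

theorem kd_artinian_of_op (S : Type*) [Ring S] [IsArtinianRing Sᵐᵒᵖ] [IsNoetherianRing S] :
    IsArtinianRing S := by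
  have hsp : IsSemiprimaryRing S := by
    constructor
    · rw [← isSemisimpleRing_mulOpposite_iff]
      let f : Sᵐᵒᵖ ⧸ Ring.jacobson Sᵐᵒᵖ →+* (S ⧸ Ring.jacobson S)ᵐᵒᵖ :=
        Ideal.Quotient.lift _ (RingHom.op (Ideal.Quotient.mk (Ring.jacobson S))) (by
          intro a ha
          have : unop a ∈ Ring.jacobson S := kd_op_mem.1 (by simpa using ha)
          simpa [Ideal.Quotient.eq_zero_iff_mem] using this)
      refine RingHom.isSemisimpleRing_of_surjective f ?_
      intro z
      obtain ⟨w, hw⟩ := Ideal.Quotient.mk_surjective (unop z)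
      exact ⟨Ideal.Quotient.mk _ (op w), by simp [f, hw]⟩
    · obtain ⟨n, hn⟩ := IsSemiprimaryRing.isNilpotent (R := Sᵐᵒᵖ)
      have key : ∀ n : ℕ, ∀ x ∈ (Ring.jacobson S) ^ n, op x ∈ (Ring.jacobson Sᵐᵒᵖ) ^ n := by
        intro n
        induction n with
        | zero => intro x _; simp [Submodule.pow_zero]
        | succ n ih =>
          intro x hx
          rcases Nat.eq_zero_or_pos n with rfl | hpos
          · rw [zero_add, Submodule.pow_one] at hx ⊢
            exact kd_op_mem.2 hx
          rw [Submodule.pow_succ] at hx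
          rw [Submodule.pow_succ' _ hpos.ne']
          induction hx using Submodule.mul_induction_on' with
          | mem_mul_mem a ha b hb =>
            rw [op_mul]
            exact Ideal.mul_mem_mul (kd_op_mem.2 hb) (ih a ha)
          | add a _ b _ h1 h2 => rw [op_add]; exact add_mem h1 h2
      refine ⟨n, ?_⟩
      rw [Ideal.zero_eq_bot, eq_bot_iff]
      intro x hx
      have := key n x hx
      rw [hn] at this
      simpa using this
  exact IsSemiprimaryRing.isNoetherian_iff_isArtinian.mp ‹_›

theorem kd_pow_quot {V : Type*} [Ring V] (y : V)
    (hart : IsArtinian V (V ⧸ (Ideal.span {y} : Ideal V))) (k : ℕ) :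
    IsArtinian V (V ⧸ (Ideal.span {y ^ k} : Ideal V)) := by
  induction k with
  | zero =>
    have : Subsingleton (V ⧸ (Ideal.span {y ^ 0} : Ideal V)) := by
      rw [Submodule.Quotient.subsingleton_iff]; simp
    infer_instance
  | succ k ih =>
    let f : (V ⧸ (Ideal.span {y} : Ideal V)) →ₗ[V] (V ⧸ (Ideal.span {y ^ (k+1)} : Ideal V)) :=
      Submodule.mapQ _ _ (LinearMap.toSpanSingleton V V (y ^ k)) (by
        rw [Ideal.span, Submodule.span_le]
        intro a ha
        rw [Set.mem_singleton_iff] at ha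
        subst ha
        simp [← pow_succ'])
    let g : (V ⧸ (Ideal.span {y ^ (k+1)} : Ideal V)) →ₗ[V] (V ⧸ (Ideal.span {y ^ k} : Ideal V)) :=
      Submodule.factor (by
        rw [Ideal.span, Submodule.span_le]
        intro a ha
        rw [Set.mem_singleton_iff] at ha
        subst ha
        rw [pow_succ']
        exact Ideal.mul_mem_left _ _ (Ideal.mem_span_singleton_self _))
    refine isArtinian_of_range_eq_ker f g ?_
    ext z
    obtain ⟨z, rfl⟩ := Submodule.mkQ_surjective _ z
    rw [LinearMap.mem_ker]
    have hg : g (Submodule.mkQ _ z) = Submodule.Quotient.mk z := rfl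
    rw [hg, Submodule.Quotient.mk_eq_zero, Ideal.mem_span_singleton']
    constructor
    · rintro ⟨w, hw⟩
      obtain ⟨w, rfl⟩ := Submodule.mkQ_surjective _ w
      have hf : f (Submodule.mkQ _ w) = Submodule.Quotient.mk (w * y ^ k) := rfl
      rw [hf, Submodule.mkQ_apply, Submodule.Quotient.eq, Ideal.mem_span_singleton'] at hw
      obtain ⟨a, ha⟩ := hw
      refine ⟨w - a * y, ?_⟩
      rw [sub_mul, mul_assoc, ← pow_succ', ha]; abel
    · rintro ⟨a, rfl⟩
      exact ⟨Submodule.Quotient.mk a, rfl⟩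

theorem kd_torsion {V : Type*} [Ring V] (y : V)
    (hart : IsArtinian V (V ⧸ (Ideal.span {y} : Ideal V)))
    (M : Type*) [AddCommGroup M] [Module V M] [Module.Finite V M]
    (h : ∀ m : M, ∃ k : ℕ, y ^ k • m = 0) : IsArtinian V M := by
  obtain ⟨s, fin, span⟩ := Submodule.fg_def.mp (Module.finite_def.mp ‹Module.Finite V M›)
  rw [← s.iUnion_of_singleton_coe, Submodule.span_iUnion] at span
  rw [← Set.finite_coe_iff] at fin
  have _ (i : M) : IsArtinian V (Submodule.span V {i}) := by
    obtain ⟨k, hk⟩ := h i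
    have := kd_pow_quot y hart k
    let f : (V ⧸ (Ideal.span {y ^ k} : Ideal V)) →ₗ[V] M :=
      Submodule.liftQ _ (LinearMap.toSpanSingleton V M i) (by
        rw [Ideal.span, Submodule.span_le]
        intro a ha
        rw [Set.mem_singleton_iff] at ha
        subst ha
        simpa using hk)
    have hr : LinearMap.range f = Submodule.span V {i} := by
      rw [Submodule.range_liftQ, LinearMap.range_toSpanSingleton]
    rw [← hr]
    infer_instance
  have : IsArtinian V (⊤ : Submodule V M) := by
    rw [← span]
    infer_instance
  exact isArtinian_of_linearEquiv Submodule.topEquiv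

/-- `y`-saturation of a left ideal. -/
def kdSat {V : Type*} [Ring V] (y : V) (hnorm : ∀ a : V, ∃ b : V, y * a = b * y)
    (N : Ideal V) : Ideal V where
  carrier := {u | ∃ k : ℕ, y ^ k * u ∈ N}
  zero_mem' := ⟨0, by simp⟩
  add_mem' := by
    rintro a b ⟨k, hk⟩ ⟨l, hl⟩
    refine ⟨k + l, ?_⟩
    rw [mul_add]
    refine add_mem ?_ ?_
    · rw [add_comm, pow_add, mul_assoc]; exact N.mul_mem_left _ hk
    · rw [pow_add, mul_assoc]; exact N.mul_mem_left _ hl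
  smul_mem' := by
    rintro c x ⟨k, hk⟩
    refine ⟨k, ?_⟩
    have : ∀ (k : ℕ) (a : V), ∃ b, y ^ k * a = b * y ^ k := by
      intro k
      induction k with
      | zero => intro a; exact ⟨a, by simp⟩
      | succ k ih =>
        intro a
        obtain ⟨b, hb⟩ := ih a
        obtain ⟨c, hc⟩ := hnorm b
        exact ⟨c, by rw [pow_succ', mul_assoc, hb, ← mul_assoc, hc, mul_assoc]⟩
    obtain ⟨b, hb⟩ := this k c
    rw [smul_eq_mul, ← mul_assoc, hb, mul_assoc]
    exact N.mul_mem_left _ hk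

theorem kd_main {V : Type*} [Ring V] [IsNoetherianRing V] (y : V)
    (hyJ : y ∈ Ring.jacobson V)
    (hnorm₁ : ∀ a : V, ∃ b : V, y * a = b * y)
    (hnorm₂ : ∀ a : V, ∃ b : V, a * y = y * b)
    (hart : IsArtinian V (V ⧸ (Ideal.span {y} : Ideal V))) : KrullDimLEOne V V := by
  intro N hN
  let S : ℕ → Submodule V V := fun n => kdSat y hnorm₁ (N n)
  have hS : Antitone S := by
    refine antitone_nat_of_succ_le fun n => ?_
    rintro u ⟨k, hk⟩
    exact ⟨k, hN n hk⟩
  have hNS : ∀ n, N n ≤ S n := fun n u hu => ⟨0, by simpa using hu⟩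
  obtain ⟨t, ht⟩ := IsArtinian.monotone_stabilizes
    (R := V) (M := V ⧸ (Ideal.span {y} : Ideal V))
    ⟨fun n => OrderDual.toDual ((S n).map (Submodule.mkQ (Ideal.span {y} : Ideal V))),
      fun a b hab => Submodule.map_mono (hS hab)⟩
  refine ⟨t, fun n hn => ?_⟩
  have hle : S n ≤ S (n + 1) := by
    have hst : (S n).map (Submodule.mkQ (Ideal.span {y} : Ideal V)) =
        (S (n+1)).map (Submodule.mkQ (Ideal.span {y} : Ideal V)) :=
      (ht n hn).symm.trans (ht (n+1) (by omega))
    have hdec : ∀ u ∈ S n, ∃ v ∈ S (n+1), ∃ w ∈ S n, u = v + y * w := by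
      intro u hu
      have : Submodule.mkQ (Ideal.span {y} : Ideal V) u ∈
          (S (n+1)).map (Submodule.mkQ (Ideal.span {y} : Ideal V)) :=
        hst ▸ Submodule.mem_map_of_mem hu
      obtain ⟨v, hv, hvu⟩ := this
      have h1 : u - v ∈ (Ideal.span {y} : Ideal V) :=
        (Submodule.Quotient.eq _).1 hvu.symm
      obtain ⟨a, ha⟩ := Ideal.mem_span_singleton'.1 h1
      obtain ⟨b, hb⟩ := hnorm₂ a
      refine ⟨v, hv, b, ?_, by rw [← hb, ha]; abel⟩
      have h2 : y * b ∈ S n := by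
        rw [← hb, ha]; exact sub_mem hu (hS (Nat.le_succ n) hv)
      obtain ⟨k, hk⟩ := h2
      exact ⟨k + 1, by rwa [pow_succ, mul_assoc]⟩
    have hbot : (S n).map (Submodule.mkQ (S (n+1))) = ⊥ := by
      refine Submodule.FG.eq_bot_of_le_jacobson_smul (IsNoetherian.noetherian _) ?_
      rintro _ ⟨u, hu, rfl⟩
      obtain ⟨v, hv, w, hw, rfl⟩ := hdec u hu
      have : Submodule.mkQ (S (n+1)) (v + y * w) = y • Submodule.mkQ (S (n+1)) w := by
        rw [map_add, ← smul_eq_mul, map_smul, Submodule.mkQ_apply,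
          (Submodule.Quotient.mk_eq_zero _).2 hv, zero_add]
      rw [this]
      exact Submodule.smul_mem_smul hyJ (Submodule.mem_map_of_mem hw)
    intro u hu
    have : Submodule.mkQ (S (n+1)) u ∈ (S n).map (Submodule.mkQ (S (n+1))) :=
      Submodule.mem_map_of_mem hu
    rw [hbot, Submodule.mem_bot] at this
    exact (Submodule.Quotient.mk_eq_zero _).1 this
  refine kd_torsion y hart _ ?_
  intro m
  obtain ⟨m, rfl⟩ := Submodule.mkQ_surjective _ m
  obtain ⟨k, hk⟩ := hle (hNS n m.2)
  refine ⟨k, ?_⟩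
  rw [← map_smul, Submodule.mkQ_apply, Submodule.Quotient.mk_eq_zero]
  exact hk

theorem kd_quot_iff {V : Type*} [Ring V] (I : Ideal V) [I.IsTwoSided] :
    IsArtinian V (V ⧸ I) ↔ IsArtinianRing (V ⧸ I) := by
  let e : V ⧸ I →ₛₗ[Ideal.Quotient.mk I] V ⧸ I := ⟨.id _, fun _ _ ↦ rfl⟩
  exact e.isArtinian_iff_of_bijective Function.bijective_id

theorem kd_twoSided {V : Type*} [Ring V] (y : V)
    (hnorm₁ : ∀ a : V, ∃ b : V, y * a = b * y) :
    (Ideal.span {y} : Ideal V).IsTwoSided := by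
  constructor
  intro a b ha
  obtain ⟨c, rfl⟩ := Ideal.mem_span_singleton'.1 ha
  obtain ⟨d, hd⟩ := hnorm₁ b
  rw [mul_assoc, hd, ← mul_assoc]
  exact Ideal.mul_mem_left _ _ (Ideal.mem_span_singleton_self _)

theorem krull_dim_le_one_of_complete_artinian_quotient
    (U : Type*) [Ring U] [IsNoetherianRing U] [IsNoetherianRing Uᵐᵒᵖ]
    (y : U)
    (hyJ : y ∈ (⊥ : Ideal U).jacobson)
    (hreg₁ : ∀ a : U, y * a = 0 → a = 0) (hreg₂ : ∀ a : U, a * y = 0 → a = 0)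
    (hnorm₁ : ∀ a : U, ∃ b : U, y * a = b * y)
    (hnorm₂ : ∀ a : U, ∃ b : U, a * y = y * b)
    (hart : IsArtinian U (U ⧸ (Ideal.span {y} : Ideal U)))
    (hcomp : ZAdicComplete U y) :
    KrullDimLEOne U U ∧ KrullDimLEOne Uᵐᵒᵖ Uᵐᵒᵖ := by
  rw [Ideal.jacobson_bot] at hyJ
  refine ⟨kd_main y hyJ hnorm₁ hnorm₂ hart, ?_⟩
  have hn1 : ∀ a : Uᵐᵒᵖ, ∃ b : Uᵐᵒᵖ, op y * a = b * op y := by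
    intro a
    obtain ⟨b, hb⟩ := hnorm₂ (unop a)
    exact ⟨op b, unop_injective (by simpa using hb)⟩
  have hn2 : ∀ a : Uᵐᵒᵖ, ∃ b : Uᵐᵒᵖ, a * op y = op y * b := by
    intro a
    obtain ⟨b, hb⟩ := hnorm₁ (unop a)
    exact ⟨op b, unop_injective (by simpa using hb)⟩
  refine kd_main (op y) (kd_op_mem.2 hyJ) hn1 hn2 ?_
  have i1 := kd_twoSided y hnorm₁
  have i2 := kd_twoSided (op y) hn1
  rw [kd_quot_iff] at hart ⊢
  have hnoeth : IsNoetherianRing (Uᵐᵒᵖ ⧸ (Ideal.span {op y} : Ideal Uᵐᵒᵖ)) :=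
    isNoetherianRing_of_surjective _ _ (Ideal.Quotient.mk _) Ideal.Quotient.mk_surjective
  let g : U →+* (Uᵐᵒᵖ ⧸ (Ideal.span {op y} : Ideal Uᵐᵒᵖ))ᵐᵒᵖ :=
    (RingHom.op (Ideal.Quotient.mk (Ideal.span {op y} : Ideal Uᵐᵒᵖ))).comp
      (RingEquiv.opOp U).toRingHom
  have hg : ∀ u : U, g u = op (Ideal.Quotient.mk (Ideal.span {op y} : Ideal Uᵐᵒᵖ) (op u)) :=
    fun u => rfl
  let f : U ⧸ (Ideal.span {y} : Ideal U) →+* (Uᵐᵒᵖ ⧸ (Ideal.span {op y} : Ideal Uᵐᵒᵖ))ᵐᵒᵖ :=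
    Ideal.Quotient.lift _ g (by
      intro a ha
      obtain ⟨c, rfl⟩ := Ideal.mem_span_singleton'.1 ha
      obtain ⟨d, hd⟩ := hnorm₂ c
      rw [hg, hd, op_mul, op_eq_zero_iff, Ideal.Quotient.eq_zero_iff_mem]
      exact Ideal.mul_mem_left _ _ (Ideal.mem_span_singleton_self _))
  have hf : Function.Surjective f := by
    intro z
    obtain ⟨w, hw⟩ := Ideal.Quotient.mk_surjective (unop z)
    refine ⟨Ideal.Quotient.mk _ (unop w), ?_⟩
    change g (unop w) = z
    rw [hg, op_unop, hw, op_unop]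
  have := hf.isArtinianRing
  exact kd_artinian_of_op _
end

section
/- Let $A$ be a prime Noetherian ring of Krull dimension $1$ with a regular normal element $z \in J(A)$ such that $A/zA$ is Artinian and $A$ is $z$-adically complete, and let $B$ be an order in $Q(A)$ containing $A$ and equivalent to $A$. Then $B$ is semilocal, i.e., $B/J(B)$ is Artinian. -/
/-- If `A` has Krull dimension at most one and `c` is right regular then `A / Ac` is Artinian. -/
theorem artinian_quot_of_regular {R : Type*} [Ring R] (hK : KrullDimLEOne R R) (c : R)
    (hc : ∀ x : R, x * c = 0 → x = 0) : IsArtinian R (R ⧸ (Ideal.span {c} : Ideal R)) := by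
  have hcn : ∀ n : ℕ, ∀ x : R, x * c ^ n = 0 → x = 0 := by
    intro n
    induction n with
    | zero => intro x hx; simpa using hx
    | succ n ih =>
      intro x hx
      rw [pow_succ, ← mul_assoc] at hx
      exact ih x (hc _ hx)
  obtain ⟨t, ht⟩ := hK (fun n => Ideal.span {c ^ n}) (by
    intro n
    refine (Ideal.span_singleton_le_iff_mem _).2 ?_
    exact Ideal.mem_span_singleton'.2 ⟨c, (pow_succ' c n).symm⟩)
  have h := ht t le_rfl
  let N : Submodule R R := Ideal.span {c ^ t}
  let N' : Submodule R R := Ideal.span {c ^ (t + 1)}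
  let g : R →ₗ[R] N := (LinearMap.toSpanSingleton R R (c ^ t)).codRestrict N (fun x =>
    Ideal.mem_span_singleton'.2 ⟨x, rfl⟩)
  let f : R →ₗ[R] (N ⧸ (Submodule.comap N.subtype N')) := (Submodule.mkQ _).comp g
  have hk : LinearMap.ker f = (Ideal.span {c} : Ideal R) := by
    ext x
    have h1 : f x = 0 ↔ x * c ^ t ∈ N' := by
      change Submodule.Quotient.mk (g x) = 0 ↔ _
      rw [Submodule.Quotient.mk_eq_zero]
      rfl
    rw [LinearMap.mem_ker, h1]
    constructor
    · intro hx
      obtain ⟨y, hy⟩ := Ideal.mem_span_singleton'.1 hx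
      refine Ideal.mem_span_singleton'.2 ⟨y, ?_⟩
      have : (y * c - x) * c ^ t = 0 := by
        rw [sub_mul, mul_assoc, ← pow_succ', hy, sub_self]
      exact sub_eq_zero.1 (hcn t _ this)
    · intro hx
      obtain ⟨y, rfl⟩ := Ideal.mem_span_singleton'.1 hx
      exact Ideal.mem_span_singleton'.2 ⟨y, by rw [mul_assoc, ← pow_succ']⟩
  rw [← hk]
  haveI : IsArtinian R (N ⧸ (Submodule.comap N.subtype N')) := h
  exact isArtinian_of_injective ((LinearMap.ker f).liftQ f le_rfl)
    (LinearMap.ker_eq_bot.1 (Submodule.ker_liftQ_eq_bot _ _ _ le_rfl))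

/-- A power of `z ∈ J(R)` lies in `Rc` as soon as `R / Rc` is Artinian. -/
theorem pow_mem_of_artinian {R : Type*} [Ring R] (z c : R) (hz : z ∈ (⊥ : Ideal R).jacobson)
    (h : IsArtinian R (R ⧸ (Ideal.span {c} : Ideal R))) : ∃ (n : ℕ) (y : R), z ^ n = y * c := by
  let I : Ideal R := Ideal.span {c}
  have hanti : Antitone (fun n : ℕ => Submodule.map (Submodule.mkQ I) (Ideal.span {z ^ n})) := by
    refine antitone_nat_of_succ_le fun n => Submodule.map_mono ?_
    refine (Ideal.span_singleton_le_iff_mem _).2 ?_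
    exact Ideal.mem_span_singleton'.2 ⟨z, (pow_succ' z n).symm⟩
  obtain ⟨n, hn⟩ := IsArtinian.monotone_stabilizes (R := R) (M := R ⧸ I)
    ⟨fun n => OrderDual.toDual (Submodule.map (Submodule.mkQ I) (Ideal.span {z ^ n})), hanti⟩
  have h1 : Submodule.map (Submodule.mkQ I) (Ideal.span {z ^ n}) =
      Submodule.map (Submodule.mkQ I) (Ideal.span {z ^ (n + 1)}) := hn (n + 1) (Nat.le_succ n)
  have h2 : Submodule.mkQ I (z ^ n) ∈ Submodule.map (Submodule.mkQ I) (Ideal.span {z ^ (n + 1)}) := by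
    rw [← h1]
    exact Submodule.mem_map_of_mem (Ideal.mem_span_singleton_self _)
  obtain ⟨v, hv, hv'⟩ := Submodule.mem_map.1 h2
  obtain ⟨s, rfl⟩ := Ideal.mem_span_singleton'.1 hv
  have h3 : z ^ n - s * z ^ (n + 1) ∈ I := (Submodule.Quotient.eq I).1 hv'.symm
  obtain ⟨t, ht⟩ := Ideal.mem_span_singleton'.1 h3
  obtain ⟨w, hw⟩ := Ideal.mem_jacobson_iff.1 hz (-s)
  rw [Ideal.mem_bot] at hw
  refine ⟨n, w * t, ?_⟩
  have h4 : w * (z ^ n - s * z ^ (n + 1)) = z ^ n := by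
    have : w * (z ^ n - s * z ^ (n + 1)) = (w * -s * z + w - 1) * z ^ n + z ^ n := by
      rw [pow_succ']; noncomm_ring
    rw [this, hw]; simp
  rw [mul_assoc, ht, h4]

theorem equivalent_order_is_semilocal
    (Q : Type*) [Ring Q] [Nontrivial Q]
    (A B : Subring Q) (hAB : A ≤ B)
    -- `Q` is the classical (Goldie) ring of quotients of `A`:
    -- every element of `Q` is a right fraction over `A` ...
    (hQfrac : ∀ q : Q, ∃ a c : Q, a ∈ A ∧ c ∈ A ∧ IsUnit c ∧ q * c = a)
    -- ... and every regular element of `A` is a unit in `Q`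
    (hQreg : ∀ c ∈ A, (∀ x ∈ A, c * x = 0 → x = 0) → (∀ x ∈ A, x * c = 0 → x = 0) → IsUnit c)
    -- `A` is prime and Noetherian
    [IsNoetherianRing ↥A] [IsNoetherianRing (↥A)ᵐᵒᵖ]
    (hprime : ∀ a b : ↥A, (∀ x : ↥A, a * x * b = 0) → a = 0 ∨ b = 0)
    -- `A` has Krull dimension exactly one (at most one, and `A` is not Artinian)
    (hK1 : KrullDimLEOne ↥A ↥A) (hK1' : KrullDimLEOne (↥A)ᵐᵒᵖ (↥A)ᵐᵒᵖ)
    (hnotart : ¬ IsArtinianRing ↥A)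
    -- the regular normal element `z ∈ J(A)`
    (z : ↥A)
    (hzJ : z ∈ (⊥ : Ideal ↥A).jacobson)
    (hreg₁ : ∀ a : ↥A, z * a = 0 → a = 0) (hreg₂ : ∀ a : ↥A, a * z = 0 → a = 0)
    (hnorm₁ : ∀ a : ↥A, ∃ b : ↥A, z * a = b * z)
    (hnorm₂ : ∀ a : ↥A, ∃ b : ↥A, a * z = z * b)
    (hart : IsArtinian ↥A (↥A ⧸ (Ideal.span {z} : Ideal ↥A)))
    (hcomp : ZAdicComplete ↥A z)
    -- `B` is an order equivalent to `A`: `aBb ⊆ A` for some units `a, b` of `Q(A)`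
    (hequiv : ∃ a b : Qˣ, ∀ x ∈ B, (a : Q) * x * (b : Q) ∈ A) :
    IsArtinian ↥B (↥B ⧸ ((⊥ : Ideal ↥B).jacobson)) := by
  have hzu : IsUnit (z : Q) := by
    refine hQreg z z.2 (fun x hx h => ?_) (fun x hx h => ?_)
    · have := hreg₁ ⟨x, hx⟩ (Subtype.ext h)
      exact congrArg Subtype.val this
    · have := hreg₂ ⟨x, hx⟩ (Subtype.ext h)
      exact congrArg Subtype.val this
  have hartu : ∀ c : A, IsUnit (c : Q) → IsArtinian A (A ⧸ (Ideal.span {c} : Ideal A)) := by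
    intro c hc
    refine artinian_quot_of_regular hK1 c fun x hx => ?_
    have h : (x : Q) * (c : Q) = 0 := congrArg Subtype.val hx
    exact Subtype.ext (hc.mul_left_eq_zero.1 h)
  have hnormpow : ∀ (n : ℕ) (e : A), ∃ e' : A, e * z ^ n = z ^ n * e' := by
    intro n
    induction n with
    | zero => intro e; exact ⟨e, by simp⟩
    | succ n ih =>
      intro e
      obtain ⟨e₁, h₁⟩ := ih e
      obtain ⟨e₂, h₂⟩ := hnorm₂ e₁
      exact ⟨e₂, by rw [pow_succ, ← mul_assoc, h₁, mul_assoc, h₂, ← mul_assoc]⟩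
  obtain ⟨k, hk⟩ : ∃ k : ℕ, ∀ u ∈ B, u * (z : Q) ^ k ∈ A := by
    obtain ⟨a, b, hab⟩ := hequiv
    obtain ⟨a₁, c, ha₁, hc, hcu, hac⟩ := hQfrac a
    obtain ⟨b₁, d, hb₁, hd, hdu, hbd⟩ := hQfrac b
    have ha₁u : IsUnit a₁ := hac ▸ a.isUnit.mul hcu
    have hb₁u : IsUnit b₁ := hbd ▸ b.isUnit.mul hdu
    have hab₁ : ∀ x ∈ B, a₁ * x * b₁ ∈ A := by
      intro x hx
      have h := A.mul_mem (hab (c * x) (B.mul_mem (hAB hc) hx)) hd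
      have h' : a₁ * x * b₁ = (a : Q) * (c * x) * b * d := by
        rw [← hac, ← hbd]; noncomm_ring
      rw [h']; exact h
    obtain ⟨n, x, hx⟩ := pow_mem_of_artinian z ⟨a₁, ha₁⟩ hzJ (hartu ⟨a₁, ha₁⟩ ha₁u)
    obtain ⟨m, y, hy⟩ := pow_mem_of_artinian z ⟨b₁, hb₁⟩ hzJ (hartu ⟨b₁, hb₁⟩ hb₁u)
    have hx' : (z : Q) ^ n = x * a₁ := by simpa using congrArg Subtype.val hx
    have hy' : (z : Q) ^ m = y * b₁ := by simpa using congrArg Subtype.val hy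
    refine ⟨n + m, fun u hu => ?_⟩
    let e : A := x * ⟨a₁ * u * b₁, hab₁ u hu⟩
    have he : (e : Q) = (z : Q) ^ n * u * b₁ := by
      rw [hx']; simp [e, mul_assoc]
    obtain ⟨y', hyy⟩ := hnormpow (m + n) y
    obtain ⟨e', hee⟩ := hnormpow n e
    have hyy' : (y : Q) * (z : Q) ^ (m + n) = (z : Q) ^ (m + n) * y' := by
      simpa using congrArg Subtype.val hyy
    have hee' : (e : Q) * (z : Q) ^ n = (z : Q) ^ n * e' := by
      simpa using congrArg Subtype.val hee
    have hzm : IsUnit ((z : Q) ^ m) := hzu.pow m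
    have hzn : IsUnit ((z : Q) ^ n) := hzu.pow n
    have hb : b₁ * ((z : Q) ^ n * y') = (z : Q) ^ (m + n) := by
      have hyu : IsUnit (y : Q) := by
        obtain ⟨v, hv⟩ := hb₁u
        have : (y : Q) = (z : Q) ^ m * (v⁻¹ : Qˣ) := by
          rw [hy', ← hv, mul_assoc, Units.mul_inv, mul_one]
        rw [this]
        exact hzm.mul (Units.isUnit _)
      refine hyu.mul_left_cancel ?_
      rw [← mul_assoc, ← hy', hyy', pow_add, mul_assoc]
    have hfin : u * (z : Q) ^ (n + m) = e' * y' := by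
      refine hzn.mul_left_cancel ?_
      rw [add_comm n m, ← hb, ← mul_assoc (_ ^ n) (e' : Q), ← hee', he]
      noncomm_ring
    rw [hfin]
    exact A.mul_mem e'.2 y'.2
  have hJ : ∀ (c : A) (x : B), (x : Q) = c * (z : Q) ^ (k + 1) → x ∈ (⊥ : Ideal B).jacobson := by
    intro c x hx
    refine Ideal.mem_jacobson_iff.2 fun y => ?_
    let p : A := ⟨y * c * (z : Q) ^ k, hk _ (B.mul_mem y.2 (hAB c.2))⟩
    obtain ⟨w, hw⟩ := Ideal.mem_jacobson_iff.1 hzJ p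
    rw [Ideal.mem_bot] at hw
    have hw' : (w : Q) * (y * c * (z : Q) ^ k) * z + w - 1 = 0 := congrArg Subtype.val hw
    refine ⟨⟨w, hAB w.2⟩, ?_⟩
    rw [Ideal.mem_bot]
    refine Subtype.ext ?_
    change (w : Q) * y * x + w - 1 = 0
    rw [← hw', hx, pow_succ]
    noncomm_ring
  let M : ℕ := (k + 1) + k
  let J : Ideal B := (⊥ : Ideal B).jacobson
  let I : Ideal A := Ideal.span {z ^ M}
  have hI : IsArtinian A (A ⧸ I) := hartu (z ^ M) (by simpa using hzu.pow M)
  let f : Submodule B (B ⧸ J) → Submodule A (A ⧸ I) := fun P =>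
    { carrier := {v | ∃ (b : B) (a : A), (a : Q) = b * (z : Q) ^ k ∧
        (Submodule.Quotient.mk b : B ⧸ J) ∈ P ∧ (Submodule.Quotient.mk a : A ⧸ I) = v}
      add_mem' := by
        rintro _ _ ⟨b, a, h, hb, rfl⟩ ⟨b', a', h', hb', rfl⟩
        refine ⟨b + b', a + a', ?_, ?_, rfl⟩
        · push_cast; rw [h, h', add_mul]
        · exact P.add_mem hb hb'
      zero_mem' := ⟨0, 0, by simp, P.zero_mem, rfl⟩
      smul_mem' := by
        rintro r _ ⟨b, a, h, hb, rfl⟩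
        refine ⟨⟨r, hAB r.2⟩ * b, r * a, ?_, ?_, rfl⟩
        · push_cast; rw [h, mul_assoc]
        · exact P.smul_mem ⟨r, hAB r.2⟩ hb }
  have hmono : ∀ P P', P ≤ P' → f P ≤ f P' := by
    rintro P P' hP _ ⟨b, a, h, hb, rfl⟩
    exact ⟨b, a, h, hP hb, rfl⟩
  have hinj : ∀ P P', f P ≤ f P' → P ≤ P' := by
    intro P P' hP v hv
    obtain ⟨b, rfl⟩ := Submodule.Quotient.mk_surjective J v
    obtain ⟨b', a', h', hb', hv'⟩ :=
      hP (show (Submodule.Quotient.mk ⟨b * (z : Q) ^ k, hk b b.2⟩ : A ⧸ I) ∈ f P from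
        ⟨b, _, rfl, hv, rfl⟩)
    have hd := (Submodule.Quotient.eq I).1 hv'.symm
    obtain ⟨c, hc⟩ := Ideal.mem_span_singleton'.1 hd
    have hc' : (c : Q) * (z : Q) ^ M = b * (z : Q) ^ k - a' := by
      simpa using congrArg Subtype.val hc
    have hbb : ((b - b' : B) : Q) = c * (z : Q) ^ (k + 1) := by
      refine (hzu.pow k).mul_right_cancel ?_
      push_cast
      rw [sub_mul, ← h', ← hc', mul_assoc, ← pow_add]
    have : (Submodule.Quotient.mk b : B ⧸ J) = Submodule.Quotient.mk b' :=
      (Submodule.Quotient.eq J).2 (hJ c _ hbb)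
    rw [this]
    exact hb'
  have hstrict : StrictMono f := fun P P' h =>
    lt_of_le_not_ge (hmono _ _ h.le) fun h' => h.not_ge (hinj _ _ h')
  haveI : WellFoundedLT (Submodule A (A ⧸ I)) := hI
  exact hstrict.wellFoundedLT
end

section
/- Let $G$ be a complete $p$-valued group of finite rank with $p$-valuation $\omega$, and let $\tilde{G} = \mathrm{Sat}(G)$ be its saturation. If $\varphi \in \mathrm{Aut}(G)$ satisfies $\deg_\omega(\varphi) > 1/(p-1)$ and $\tilde{\varphi}$ denotes its unique extension to $\tilde{G}$, then $\deg_\omega(\tilde{\varphi}) = \deg_\omega(\varphi)$; in particular the map $\varphi \mapsto \tilde{\varphi}$ is an isometric embedding $\mathrm{Aut}^\omega(G) \hookrightarrow \mathrm{Aut}^\omega(\tilde{G})$. -/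
/-- A real-indexed filtration given by predicates `V s`. -/
structure PFilt {G : Type*} [Group G] (V : ℝ → G → Prop) : Prop where
  one : ∀ s, V s 1
  mul : ∀ s x y, V s x → V s y → V s (x * y)
  inv : ∀ s x, V s x → V s x⁻¹
  mono : ∀ s t x, s ≤ t → V t x → V s x
  comm : ∀ s t x y, V s x → V t y → V (s + t) (x⁻¹ * y⁻¹ * x * y)

/-- Polynomial sequences (up to order `K`) with respect to the filtration. -/
def PolyK {G : Type*} [Group G] (V : ℝ → G → Prop) (b : ℝ) : ℕ → ℝ → (ℕ → G) → Prop
  | 0, s, f => ∀ n, V s (f n)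
  | K + 1, s, f => (∀ n, V s (f n)) ∧ PolyK V b K (s + b) (fun n => (f n)⁻¹ * f (n + 1))

section poly
variable {G : Type*} [Group G] {V : ℝ → G → Prop} {b : ℝ}

lemma PolyK.val {K : ℕ} {s : ℝ} {f : ℕ → G} (h : PolyK V b K s f) : ∀ n, V s (f n) := by
  cases K with
  | zero => exact h
  | succ K => exact h.1

lemma PolyK.mono (hV : PFilt V) : ∀ {K : ℕ} {s t : ℝ} {f : ℕ → G}, s ≤ t →
    PolyK V b K t f → PolyK V b K s f := by
  intro K
  induction K with
  | zero => intro s t f hst h n; exact hV.mono _ _ _ hst (h n)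
  | succ K ih =>
    intro s t f hst h
    exact ⟨fun n => hV.mono _ _ _ hst (h.1 n), ih (by linarith) h.2⟩

lemma PolyK.pred : ∀ {K : ℕ} {s : ℝ} {f : ℕ → G},
    PolyK V b (K + 1) s f → PolyK V b K s f := by
  intro K
  induction K with
  | zero => intro s f h; exact h.1
  | succ K ih => intro s f h; exact ⟨h.1, ih h.2⟩

lemma PolyK.shift : ∀ {K : ℕ} {s : ℝ} {f : ℕ → G},
    PolyK V b K s f → PolyK V b K s (fun n => f (n + 1)) := by
  intro K
  induction K with
  | zero => intro s f h n; exact h (n + 1)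
  | succ K ih => intro s f h; exact ⟨fun n => h.1 (n + 1), ih h.2⟩

lemma PolyK.const (hV : PFilt V) : ∀ {K : ℕ} {s : ℝ} {g : G}, V s g →
    PolyK V b K s (fun _ => g) := by
  intro K
  induction K with
  | zero => intro s g h n; exact h
  | succ K ih =>
    intro s g h
    refine ⟨fun _ => h, ?_⟩
    have := ih (s := s + b) (hV.one _)
    simpa using this

lemma PolyK.closure (hV : PFilt V) (hb : 0 ≤ b) : ∀ K : ℕ,
    (∀ (s : ℝ) (f g : ℕ → G), 0 ≤ s → PolyK V b K s f → PolyK V b K s g →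
      PolyK V b K s (fun n => f n * g n)) ∧
    (∀ (s : ℝ) (f : ℕ → G), 0 ≤ s → PolyK V b K s f → PolyK V b K s (fun n => (f n)⁻¹)) ∧
    (∀ (s t : ℝ) (f g : ℕ → G), 0 ≤ s → 0 ≤ t → PolyK V b K s f → PolyK V b K t g →
      PolyK V b K (s + t) (fun n => (f n)⁻¹ * (g n)⁻¹ * f n * g n)) := by
  intro K
  induction K with
  | zero =>
    exact ⟨fun s f g _ hf hg n => hV.mul _ _ _ (hf n) (hg n),
      fun s f _ hf n => hV.inv _ _ (hf n),
      fun s t f g _ _ hf hg n => hV.comm _ _ _ _ (hf n) (hg n)⟩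
  | succ K ih =>
    obtain ⟨M, I, C⟩ := ih
    have conj : ∀ (s t : ℝ) (f g : ℕ → G), 0 ≤ s → 0 ≤ t → PolyK V b K s f →
        PolyK V b K t g → PolyK V b K s (fun n => (g n)⁻¹ * f n * g n) := by
      intro s t f g hs ht hf hg
      have := M s _ _ hs hf (PolyK.mono hV (by linarith) (C s t f g hs ht hf hg))
      convert this using 2
      group
    refine ⟨?_, ?_, ?_⟩
    · intro s f g hs hf hg
      refine ⟨fun n => hV.mul _ _ _ (hf.1 n) (hg.1 n), ?_⟩
      have := M (s + b) _ _ (by linarith)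
        (conj (s + b) s _ _ (by linarith) hs hf.2 hg.pred) hg.2
      convert this using 2
      group
    · intro s f hs hf
      refine ⟨fun n => hV.inv _ _ (hf.1 n), ?_⟩
      have := conj (s + b) s _ _ (by linarith) hs (I _ _ (by linarith) hf.2) (I _ _ hs hf.pred)
      convert this using 2
      group
    · intro s t f g hs ht hf hg
      refine ⟨fun n => hV.comm _ _ _ _ (hf.1 n) (hg.1 n), ?_⟩
      have hF := hf.2
      have hH := hg.2
      have hc := C s t f g hs ht hf.pred hg.pred
      have hst : 0 ≤ s + t := by linarith
      have h1 := conj (s + t + b) (s + t) _ _ (by linarith) hst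
        (PolyK.mono hV (by linarith)
          (C s (t + b) _ _ hs (by linarith) (PolyK.shift hf.pred) hH)) hc
      have h2 : PolyK V b K (s + t + b) _ := PolyK.mono hV (by linarith)
        (C (s + t) (t + b) _ _ hst (by linarith) hc hH)
      have h3 : PolyK V b K (s + t + b) _ := PolyK.mono hV (by linarith)
        (C (s + t) (s + b) _ _ hst (by linarith) hc hF)
      have h4 : PolyK V b K (s + t + b) _ := PolyK.mono hV (by linarith)
        (C (s + b) t _ _ (by linarith) ht hF hg.pred)
      have h5 := conj (s + t + b) (t + b) _ _ (by linarith) (by linarith)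
        (M _ _ _ (by linarith) h3 h4) hH
      have := M _ _ _ (by linarith) (M _ _ _ (by linarith) h1 h2) h5
      convert this using 2
      group

lemma PolyK.choose (hV : PFilt V) (hb : 0 ≤ b) : ∀ (j K : ℕ) (s : ℝ) (g : G),
    V (s + j * b) g → PolyK V b K s (fun n => g ^ (n.choose j)) := by
  have hpow : ∀ (s : ℝ) (g : G) (m : ℕ), V s g → V s (g ^ m) := by
    intro s g m h
    induction m with
    | zero => simpa using hV.one s
    | succ m ih => rw [pow_succ]; exact hV.mul _ _ _ ih h
  intro j
  induction j with
  | zero => intro K s g h; simpa using PolyK.const hV (K := K) (b := b) (s := s) (by simpa using h)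
  | succ j ih =>
    intro K s g h
    have h0 : V s g := hV.mono _ _ _ (by
      have : 0 ≤ ((j + 1 : ℕ) : ℝ) * b := by positivity
      linarith) h
    cases K with
    | zero => exact fun n => hpow _ _ _ h0
    | succ K =>
      refine ⟨fun n => hpow _ _ _ h0, ?_⟩
      have := ih K (s + b) g (by convert h using 1; push_cast; ring)
      convert this using 2 with n
      beta_reduce
      rw [Nat.choose_succ_succ' n j, add_comm (n.choose j), pow_add, inv_mul_cancel_left]

/-- A polynomial sequence vanishing at `0..j` has small value at `j+1`. -/
lemma PolyK.vanish : ∀ (j K : ℕ) (s : ℝ) (f : ℕ → G) (m : ℕ), j ≤ K → PolyK V b K s f →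
    (∀ i < j, f (m + i) = 1) → V (s + j * b) (f (m + j)) := by
  intro j
  induction j with
  | zero => intro K s f m _ hf _; simpa using hf.val m
  | succ j ih =>
    intro K s f m hK hf h
    obtain ⟨K, rfl⟩ : ∃ K', K = K' + 1 := ⟨K - 1, by omega⟩
    have := ih K (s + b) _ m (by omega) hf.2 (by
      intro i hi
      have e1 := h i (by omega)
      have e2 := h (i + 1) (by omega)
      rw [← add_assoc] at e2
      simp [e1, e2])
    have e := h j (by omega)
    simp only [e, inv_one, one_mul] at this
    have e3 : s + ((j + 1 : ℕ) : ℝ) * b = s + b + j * b := by push_cast; ring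
    rw [e3]
    exact this

lemma PolyK.tail (hV : PFilt V) (hb : 0 ≤ b) (p : ℕ) (hp : p.Prime)
    (hVp : ∀ s x, V s x → V (s + 1) (x ^ p)) (s c : ℝ) (hs : 0 ≤ s)
    (hc1 : c ≤ s + 2 * b + 1) (hc2 : c ≤ s + p * b) :
    ∀ (k j : ℕ) (f : ℕ → G), 2 ≤ j → j + k = p → PolyK V b p s f → (∀ i < j, f i = 1) →
      V c (f p) := by
  have hpow : ∀ (s : ℝ) (g : G) (m : ℕ), V s g → V s (g ^ m) := by
    intro s g m h
    induction m with
    | zero => simpa using hV.one s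
    | succ m ih => rw [pow_succ]; exact hV.mul _ _ _ ih h
  intro k
  induction k with
  | zero =>
    intro j f hj hjk hf h
    have := PolyK.vanish j p s f 0 (by omega) hf (by simpa using h)
    obtain rfl : j = p := by omega
    rw [zero_add] at this
    exact hV.mono _ _ _ hc2 this
  | succ k ih =>
    intro j f hj hjk hf h
    have hg := PolyK.vanish j p s f 0 (by omega) hf (by simpa using h)
    rw [zero_add] at hg
    have hq := PolyK.choose hV hb j p s (f j) hg
    obtain ⟨M, I, -⟩ := PolyK.closure hV hb p
    have hf' := M s _ _ hs (I s _ hs hq) hf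
    have := ih (j + 1) _ (by omega) (by omega) hf' (by
      intro i hi
      rcases Nat.lt_succ_iff_lt_or_eq.mp hi with hi | rfl
      · simp [h i hi, Nat.choose_eq_zero_of_lt hi]
      · simp)
    have hd : p ∣ p.choose j := hp.dvd_choose_self (by omega) (by omega)
    obtain ⟨m, hm⟩ := hd
    have hgp : V c (f j ^ p.choose j) := by
      rw [hm, mul_comm, pow_mul]
      refine hV.mono _ _ _ ?_ (hVp _ _ (hpow _ _ m hg))
      have : (2 : ℝ) ≤ j := by exact_mod_cast hj
      nlinarith
    have := hV.mul _ _ _ hgp this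
    simpa using this

/-- Key estimate. -/
lemma PolyK.key (hV : PFilt V) (p : ℕ) (hp : p.Prime)
    (hVp : ∀ s x, V s x → V (s + 1) (x ^ p)) (a : ℝ) (hb : 0 ≤ b) (hba : b ≤ a)
    (x y : G) (hx : V b x) (hz : V a (y⁻¹ * x)) (c : ℝ)
    (hc1 : c ≤ a + b + 1) (hc2 : c ≤ a + (p - 1) * b) :
    V c (((y⁻¹ * x) ^ p)⁻¹ * ((y ^ p)⁻¹ * x ^ p)) := by
  set z := y⁻¹ * x with hzdef
  have hyz : y * z = x := by simp [hzdef]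
  obtain ⟨M, I, C⟩ := PolyK.closure hV hb p
  have ha : 0 ≤ a := hb.trans hba
  have hX : PolyK V b p 0 (fun n => x ^ n) := by
    have := PolyK.choose hV hb 1 p 0 x (by simpa using hx)
    simpa using this
  have hzc : PolyK V b p a (fun _ => z) := PolyK.const hV hz
  have hu : PolyK V b p a (fun n => (x ^ n)⁻¹ * z * x ^ n) := by
    have := M a _ _ ha hzc (PolyK.mono hV (by linarith) (C a 0 _ _ ha le_rfl hzc hX))
    convert this using 2
    group
  have hΔ : ∀ n, ((y ^ n)⁻¹ * x ^ n)⁻¹ * ((y ^ (n + 1))⁻¹ * x ^ (n + 1)) =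
      (x ^ n)⁻¹ * z * x ^ n := by
    intro n
    rw [pow_succ y n, pow_succ' x n, hzdef]
    group
  have hval : ∀ n, V a ((y ^ n)⁻¹ * x ^ n) := by
    intro n
    induction n with
    | zero => simpa using hV.one a
    | succ n ih =>
      have := hV.mul _ _ _ ih (hu.val n)
      rw [← hΔ n, mul_inv_cancel_left] at this
      exact this
  have hf : PolyK V b p (a - b) (fun n => (y ^ n)⁻¹ * x ^ n) := by
    apply PolyK.pred
    refine ⟨fun n => hV.mono _ _ _ (by linarith) (hval n), ?_⟩
    simp only [hΔ]
    convert hu using 1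
    ring
  have hs : 0 ≤ a - b := by linarith
  have hq : PolyK V b p (a - b) (fun n => z ^ n) := by
    have := PolyK.choose hV hb 1 p (a - b) z (by simpa using hz)
    simpa using this
  have hf1 := M _ _ _ hs (I _ _ hs hq) hf
  exact PolyK.tail hV hb p hp hVp (a - b) c hs (by linarith) (by linarith) (p - 2) 2 _ le_rfl
    (by have := hp.two_le; omega) hf1 (by
      intro i hi
      interval_cases i
      · simp
      · simp [hzdef])

end poly

lemma pval_key {G : Type*} [Group G] (p : ℕ) (hp : p.Prime) (ω : G → WithTop ℝ)
    (hquot : ∀ x y : G, min (ω x) (ω y) ≤ ω (x * y⁻¹))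
    (hcomm : ∀ x y : G, ω x + ω y ≤ ω (x⁻¹ * y⁻¹ * x * y))
    (htop : ∀ x : G, ω x = ⊤ ↔ x = 1)
    (hgt : ∀ x : G, ((((p : ℝ) - 1)⁻¹ : ℝ) : WithTop ℝ) < ω x)
    (hpow : ∀ x : G, ω (x ^ p) = ω x + 1) (x y : G) :
    ω (x ^ p * (y ^ p)⁻¹) ≤ ω (x * y⁻¹) + 1 := by
  have h1 : ω 1 = ⊤ := (htop 1).2 rfl
  have hinv : ∀ x, ω x ≤ ω x⁻¹ := by
    intro x
    have := hquot 1 x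
    simpa [h1] using this
  have hmul : ∀ x y, min (ω x) (ω y) ≤ ω (x * y) := by
    intro x y
    have := hquot x y⁻¹
    rw [inv_inv] at this
    exact (min_le_min le_rfl (hinv y)).trans this
  have hV : PFilt (fun (s : ℝ) (x : G) => (s : WithTop ℝ) ≤ ω x) :=
    { one := fun s => by simp [h1]
      mul := fun s x y hx hy => (le_min hx hy).trans (hmul x y)
      inv := fun s x hx => hx.trans (hinv x)
      mono := fun s t x hst hx => (WithTop.coe_le_coe.2 hst).trans hx
      comm := fun s t x y hx hy => by
        rw [WithTop.coe_add]
        exact (add_le_add hx hy).trans (hcomm x y) }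
  by_cases hz : ω (x * y⁻¹) = ⊤
  · simp [hz]
  obtain ⟨a, ha⟩ := WithTop.ne_top_iff_exists.1 hz
  have hp1 : (0 : ℝ) < (p : ℝ) - 1 := by
    have : (1 : ℝ) < p := by exact_mod_cast hp.one_lt
    linarith
  obtain ⟨b, hb, hbx, hba⟩ : ∃ b : ℝ, ((p : ℝ) - 1)⁻¹ < b ∧ (b : WithTop ℝ) ≤ ω y⁻¹ ∧ b ≤ a := by
    have hga := hgt (x * y⁻¹)
    rw [← ha, WithTop.coe_lt_coe] at hga
    by_cases hy : ω y⁻¹ = ⊤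
    · exact ⟨a, hga, by simp [hy], le_rfl⟩
    · obtain ⟨c, hc⟩ := WithTop.ne_top_iff_exists.1 hy
      have hgc := hgt y⁻¹
      rw [← hc, WithTop.coe_lt_coe] at hgc
      exact ⟨min a c, lt_min hga hgc, by rw [← hc]; exact WithTop.coe_le_coe.2 (min_le_right _ _),
        min_le_left _ _⟩
  have hb0 : 0 < b := (inv_pos.2 hp1).trans hb
  have hb1 : 1 < ((p : ℝ) - 1) * b := by
    have := mul_lt_mul_of_pos_left hb hp1
    rwa [mul_inv_cancel₀ hp1.ne'] at this
  set c := min (a + b + 1) (a + ((p : ℝ) - 1) * b) with hc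
  have hca : a + 1 < c := lt_min (by linarith) (by linarith)
  have key := PolyK.key hV p hp (fun s x hx => by
      rw [hpow, WithTop.coe_add]
      exact add_le_add hx le_rfl) a hb0.le hba y⁻¹ x⁻¹ hbx (by simp [← ha]) c
      (min_le_left _ _) (min_le_right _ _)
  simp only [inv_inv, inv_pow] at key
  by_contra hcon
  rw [not_le, ← ha] at hcon
  have e : (x * y⁻¹) ^ p = (x ^ p * (y ^ p)⁻¹) *
      (((x * y⁻¹) ^ p)⁻¹ * (x ^ p * (y ^ p)⁻¹))⁻¹ := by group
  have hlt : ((a : WithTop ℝ) + 1) < ω ((x * y⁻¹) ^ p) := by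
    rw [e]
    refine lt_of_lt_of_le (lt_min hcon (lt_of_lt_of_le ?_ key)) (hquot _ _)
    exact_mod_cast hca
  rw [hpow, ← ha] at hlt
  exact lt_irrefl _ hlt

/-!
STATEMENT 11: Let `G` be a complete `p`-valued group of finite rank with `p`-valuation `ω`
and let `G̃ = Sat(G)` be its saturation (here an abstract `p`-saturated group `Gt` with an
isometric embedding `ι : G → Gt` such that every element of `Gt` has a `p^n`-th power in
`ι(G)`).  If `φ ∈ Aut(G)` satisfies `deg_ω(φ) > 1/(p-1)` and `φt` is its extension to `Gt`,
then `deg_ω(φt) = deg_ω(φ)`.  Equality of the two infima is expressed by saying that they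
have exactly the same lower bounds.
-/
theorem degree_of_extension_to_saturation
    (p : ℕ) (hp : p.Prime)
    (G Gt : Type*) [Group G] [Group Gt]
    (ω : G → WithTop ℝ) (ωt : Gt → WithTop ℝ)
    -- `ω` is a `p`-valuation on `G`:
    (hquot : ∀ x y : G, min (ω x) (ω y) ≤ ω (x * y⁻¹))
    (hcomm : ∀ x y : G, ω x + ω y ≤ ω (x⁻¹ * y⁻¹ * x * y))
    (htop : ∀ x : G, ω x = ⊤ ↔ x = 1)
    (hgt : ∀ x : G, ((((p : ℝ) - 1)⁻¹ : ℝ) : WithTop ℝ) < ω x)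
    (hpow : ∀ x : G, ω (x ^ p) = ω x + 1)
    -- `G` is complete:
    (hcomplete : ∀ c : ℕ → G,
      (∀ C : ℝ, ∃ t : ℕ, ∀ i ≥ t, ∀ j ≥ t, (C : WithTop ℝ) ≤ ω (c i * (c j)⁻¹)) →
      ∃ L : G, ∀ C : ℝ, ∃ t : ℕ, ∀ i ≥ t, (C : WithTop ℝ) ≤ ω (c i * L⁻¹))
    -- `ωt` is a `p`-valuation on `Gt`:
    (hquott : ∀ x y : Gt, min (ωt x) (ωt y) ≤ ωt (x * y⁻¹))
    (hcommt : ∀ x y : Gt, ωt x + ωt y ≤ ωt (x⁻¹ * y⁻¹ * x * y))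
    (htopt : ∀ x : Gt, ωt x = ⊤ ↔ x = 1)
    (hgtt : ∀ x : Gt, ((((p : ℝ) - 1)⁻¹ : ℝ) : WithTop ℝ) < ωt x)
    (hpowt : ∀ x : Gt, ωt (x ^ p) = ωt x + 1)
    -- `Gt` is `p`-saturated:
    (hsatt : ∀ x : Gt, (((((p : ℝ) - 1)⁻¹ + 1 : ℝ)) : WithTop ℝ) < ωt x → ∃ y : Gt, y ^ p = x)
    -- `ι : G → Gt` is an isometric embedding realising `Gt` as the saturation of `G`,
    -- and `G` has finite rank: every element of `Gt` has a `p^n`-th power in `ι(G)`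
    (ι : G →* Gt) (hinj : Function.Injective ι)
    (hiso : ∀ g : G, ωt (ι g) = ω g)
    (hfinrank : ∀ x : Gt, ∃ n : ℕ, x ^ (p ^ n) ∈ Set.range ι)
    -- `φ ∈ Aut^ω(G)`, with extension `φt` to `Gt`
    (φ : MulAut G) (φt : MulAut Gt)
    (hext : ∀ g : G, φt (ι g) = ι (φ g))
    (hdeg : ∃ d : ℝ, (((p : ℝ) - 1)⁻¹ : ℝ) < d ∧
      ∀ g : G, ω g + (d : WithTop ℝ) ≤ ω (φ g * g⁻¹)) :
    -- `deg_ω(φt) = deg_ω(φ)`: the two infima have the same lower bounds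
    ∀ d : ℝ,
      (∀ g : G, ω g + (d : WithTop ℝ) ≤ ω (φ g * g⁻¹)) ↔
      (∀ x : Gt, ωt x + (d : WithTop ℝ) ≤ ωt (φt x * x⁻¹)) := by
  intro d
  constructor
  · intro hd x
    obtain ⟨n, g, hg⟩ := hfinrank x
    have hpn : ∀ (n : ℕ) (x : Gt), ωt (x ^ p ^ n) = ωt x + ((n : ℝ) : WithTop ℝ) := by
      intro n
      induction n with
      | zero => intro x; simp
      | succ n ih =>
        intro x
        rw [pow_succ, pow_mul, hpowt, ih, add_assoc]
        push_cast
        rfl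
    have hkey : ∀ (n : ℕ) (x y : Gt), ωt (x ^ p ^ n * (y ^ p ^ n)⁻¹) ≤
        ωt (x * y⁻¹) + ((n : ℝ) : WithTop ℝ) := by
      intro n
      induction n with
      | zero => intro x y; simp
      | succ n ih =>
        intro x y
        have h1 := pval_key p hp ωt hquott hcommt htopt hgtt hpowt (x ^ p ^ n) (y ^ p ^ n)
        rw [pow_succ, pow_mul, pow_mul]
        refine h1.trans ((add_le_add (ih x y) le_rfl).trans (le_of_eq ?_))
        rw [add_assoc]
        push_cast
        rfl
    have h1 := hkey n (φt x) x
    rw [← map_pow, ← hg, hext, ← map_inv, ← map_mul, hiso] at h1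
    have h2 := (hd g).trans h1
    rw [← hiso, hg, hpn, add_right_comm] at h2
    exact (WithTop.add_le_add_iff_right WithTop.coe_ne_top).1 h2
  · intro hd g
    have := hd (ι g)
    rwa [hext, ← map_inv, ← map_mul, hiso, hiso] at this
end
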